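/- The logarithmic derivatives of ratios of theta-constants satisfy: d/dτ log(ϑ₂(τ)/ϑ₃(τ)) = (iπ/4)·ϑ₄(τ)⁴, d/dτ log(ϑ₃(τ)/ϑ₄(τ)) = (iπ/4)·ϑ₂(τ)⁴, and d/dτ log(ϑ₂(τ)/ϑ₄(τ)) = (iπ/4)·ϑ₃(τ)⁴, for all τ in the upper half-plane. -/

import Mathlib

open Complex

noncomputable def thetaC2 (τ : ℂ) : ℂ :=
  ∑' k : ℤ, Complex.exp (((k : ℂ) + 1 / 2) ^ 2 * (Real.pi : ℂ) * I * τ)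

noncomputable def thetaC3 (τ : ℂ) : ℂ :=
  ∑' k : ℤ, Complex.exp ((k : ℂ) ^ 2 * (Real.pi : ℂ) * I * τ)

noncomputable def thetaC4 (τ : ℂ) : ℂ :=
  ∑' k : ℤ, (-1 : ℂ) ^ k * Complex.exp ((k : ℂ) ^ 2 * (Real.pi : ℂ) * I * τ)

open Filter Topology

/-- The pairs of integers of even and of odd sum, parametrised by `(s + t, s - t)` and
`(s + t + 1, s - t)`. -/
def intPairParityEquiv : (ℤ × ℤ) ⊕ (ℤ × ℤ) ≃ ℤ × ℤ where
  toFun := Sum.elim (fun p ↦ (p.1 + p.2, p.1 - p.2)) (fun p ↦ (p.1 + p.2 + 1, p.1 - p.2))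
  invFun p := if (p.1 + p.2) % 2 = 0 then Sum.inl ((p.1 + p.2) / 2, (p.1 - p.2) / 2)
    else Sum.inr ((p.1 + p.2 - 1) / 2, (p.1 - p.2 - 1) / 2)
  left_inv := by
    rintro (⟨s, t⟩ | ⟨s, t⟩)
    · have h : (s + t + (s - t)) % 2 = 0 := by lia
      simp only [Sum.elim_inl, h, if_true]
      congr 2 <;> lia
    · have h : (s + t + 1 + (s - t)) % 2 ≠ 0 := by lia
      simp only [Sum.elim_inr, h, if_false]
      congr 2 <;> lia
  right_inv := by
    rintro ⟨m, n⟩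
    by_cases h : (m + n) % 2 = 0
    · simp only [h, if_true, Sum.elim_inl]
      congr 1 <;> lia
    · simp only [h, if_false, Sum.elim_inr]
      congr 1 <;> lia

lemma tsum_mul_tsum_eq_parity {f g a b c d : ℤ → ℂ}
    (hf : Summable f) (hg : Summable g) (ha : Summable a) (hb : Summable b) (hc : Summable c)
    (hd : Summable d) (heven : ∀ s t, f (s + t) * g (s - t) = a s * b t)
    (hodd : ∀ s t, f (s + t + 1) * g (s - t) = c s * d t) :
    (∑' n, f n) * ∑' n, g n = (∑' n, a n) * (∑' n, b n) + (∑' n, c n) * ∑' n, d n := by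
  rw [tsum_mul_tsum_of_summable_norm hf.norm hg.norm, tsum_mul_tsum_of_summable_norm ha.norm hb.norm,
    tsum_mul_tsum_of_summable_norm hc.norm hd.norm, ← intPairParityEquiv.tsum_eq]
  have hab := summable_mul_of_summable_norm ha.norm hb.norm
  have hcd := summable_mul_of_summable_norm hc.norm hd.norm
  exact (HasSum.sum (f := fun x ↦ f (intPairParityEquiv x).1 * g (intPairParityEquiv x).2)
    (by simpa [Function.comp_def, intPairParityEquiv, heven] using hab.hasSum)
    (by simpa [Function.comp_def, intPairParityEquiv, hodd] using hcd.hasSum)).tsum_eq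

lemma summable_thetaC3 {τ : ℂ} (hτ : 0 < τ.im) :
    Summable fun k : ℤ ↦ Complex.exp ((k : ℂ) ^ 2 * (Real.pi : ℂ) * I * τ) := by
  refine ((summable_jacobiTheta₂_term_iff 0 τ).mpr hτ).congr fun k ↦ ?_
  rw [jacobiTheta₂_term]
  ring_nf

lemma summable_thetaC4 {τ : ℂ} (hτ : 0 < τ.im) :
    Summable fun k : ℤ ↦ (-1 : ℂ) ^ k * Complex.exp ((k : ℂ) ^ 2 * (Real.pi : ℂ) * I * τ) := by
  refine (summable_thetaC3 hτ).norm.of_norm_bounded fun k ↦ ?_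
  simp

/-- The theta-constant `ϑ₂` without its leading factor `exp (πiτ/4)`. -/
noncomputable def thetaC2Reduced (τ : ℂ) : ℂ :=
  ∑' k : ℤ, Complex.exp ((k : ℂ) * (k + 1) * (Real.pi : ℂ) * I * τ)

lemma summable_thetaC2Reduced {τ : ℂ} (hτ : 0 < τ.im) :
    Summable fun k : ℤ ↦ Complex.exp ((k : ℂ) * (k + 1) * (Real.pi : ℂ) * I * τ) := by
  refine ((summable_jacobiTheta₂_term_iff (τ / 2) τ).mpr hτ).congr fun k ↦ ?_
  rw [jacobiTheta₂_term]
  ring_nf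

lemma thetaC2_term_eq (τ : ℂ) (k : ℤ) :
    Complex.exp (((k : ℂ) + 1 / 2) ^ 2 * (Real.pi : ℂ) * I * τ) =
      Complex.exp (Real.pi * I / 4 * τ) *
        Complex.exp ((k : ℂ) * (k + 1) * (Real.pi : ℂ) * I * τ) := by
  rw [← Complex.exp_add]
  ring_nf

lemma summable_thetaC2 {τ : ℂ} (hτ : 0 < τ.im) :
    Summable fun k : ℤ ↦ Complex.exp (((k : ℂ) + 1 / 2) ^ 2 * (Real.pi : ℂ) * I * τ) := by
  simp_rw [thetaC2_term_eq]
  exact (summable_thetaC2Reduced hτ).mul_left _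

lemma thetaC2_eq (τ : ℂ) :
    thetaC2 τ = Complex.exp (Real.pi * I / 4 * τ) * thetaC2Reduced τ := by
  simp_rw [thetaC2, thetaC2_term_eq, tsum_mul_left, thetaC2Reduced]

lemma thetaC3_eq_jacobiTheta₂ : thetaC3 = jacobiTheta₂ 0 := by
  ext τ
  refine tsum_congr fun k ↦ ?_
  rw [jacobiTheta₂_term]
  ring_nf

lemma thetaC4_eq_jacobiTheta₂ : thetaC4 = jacobiTheta₂ (1 / 2) := by
  ext τ
  refine tsum_congr fun k ↦ ?_
  rw [jacobiTheta₂_term, Complex.exp_add, ← Complex.exp_pi_mul_I, ← Complex.exp_int_mul]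
  ring_nf

lemma thetaC2Reduced_eq_jacobiTheta₂ (τ : ℂ) : thetaC2Reduced τ = jacobiTheta₂ (τ / 2) τ := by
  refine tsum_congr fun k ↦ ?_
  rw [jacobiTheta₂_term]
  ring_nf

lemma differentiableAt_thetaC3 {τ : ℂ} (hτ : 0 < τ.im) : DifferentiableAt ℂ thetaC3 τ := by
  rw [thetaC3_eq_jacobiTheta₂]
  exact differentiableAt_jacobiTheta₂_snd 0 hτ

lemma differentiableAt_thetaC4 {τ : ℂ} (hτ : 0 < τ.im) : DifferentiableAt ℂ thetaC4 τ := by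
  rw [thetaC4_eq_jacobiTheta₂]
  exact differentiableAt_jacobiTheta₂_snd (1 / 2) hτ

lemma differentiableAt_thetaC2Reduced {τ : ℂ} (hτ : 0 < τ.im) :
    DifferentiableAt ℂ thetaC2Reduced τ := by
  have h : thetaC2Reduced = (fun p : ℂ × ℂ ↦ jacobiTheta₂ p.1 p.2) ∘ fun τ ↦ (τ / 2, τ) :=
    funext thetaC2Reduced_eq_jacobiTheta₂
  rw [h]
  exact DifferentiableAt.comp τ (hasFDerivAt_jacobiTheta₂ (τ / 2) hτ).differentiableAt
    (by fun_prop)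

lemma hasDerivAt_thetaC2 {τ : ℂ} (hτ : 0 < τ.im) :
    HasDerivAt thetaC2 (Complex.exp (Real.pi * I / 4 * τ) *
      (Real.pi * I / 4 * thetaC2Reduced τ + deriv thetaC2Reduced τ)) τ := by
  have h : HasDerivAt (fun τ : ℂ ↦ Complex.exp (Real.pi * I / 4 * τ))
      (Complex.exp (Real.pi * I / 4 * τ) * (Real.pi * I / 4)) τ := by
    simpa using ((hasDerivAt_id τ).const_mul (Real.pi * I / 4 : ℂ)).cexp
  rw [funext thetaC2_eq]
  exact (h.mul (differentiableAt_thetaC2Reduced hτ).hasDerivAt).congr_deriv (by ring)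

lemma differentiableAt_thetaC2 {τ : ℂ} (hτ : 0 < τ.im) : DifferentiableAt ℂ thetaC2 τ :=
  (hasDerivAt_thetaC2 hτ).differentiableAt

lemma im_two_mul_pos {τ : ℂ} (hτ : 0 < τ.im) : 0 < (2 * τ).im := by
  simpa using hτ

lemma thetaC3_sq {τ : ℂ} (hτ : 0 < τ.im) :
    thetaC3 τ ^ 2 = thetaC3 (2 * τ) ^ 2 + thetaC2 (2 * τ) ^ 2 := by
  have h := im_two_mul_pos hτ
  simp only [sq (thetaC3 _), sq (thetaC2 _)]
  refine tsum_mul_tsum_eq_parity (summable_thetaC3 hτ) (summable_thetaC3 hτ)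
    (summable_thetaC3 h) (summable_thetaC3 h) (summable_thetaC2 h) (summable_thetaC2 h) ?_ ?_ <;>
  · intro s t
    simp only [← Complex.exp_add]
    push_cast
    ring_nf

lemma thetaC2_sq {τ : ℂ} (hτ : 0 < τ.im) :
    thetaC2 τ ^ 2 = 2 * thetaC2 (2 * τ) * thetaC3 (2 * τ) := by
  have h := im_two_mul_pos hτ
  have hshift : ∑' k : ℤ, Complex.exp (((k + 1 : ℤ) : ℂ) ^ 2 * (Real.pi : ℂ) * I * (2 * τ)) =
      thetaC3 (2 * τ) :=
    (Equiv.addRight (1 : ℤ)).tsum_eq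
      fun k : ℤ ↦ Complex.exp ((k : ℂ) ^ 2 * (Real.pi : ℂ) * I * (2 * τ))
  have hsum : thetaC2 τ * thetaC2 τ =
      thetaC2 (2 * τ) * thetaC3 (2 * τ) + thetaC3 (2 * τ) * thetaC2 (2 * τ) := by
    conv_rhs =>
      arg 2
      rw [← hshift]
    refine tsum_mul_tsum_eq_parity (summable_thetaC2 hτ) (summable_thetaC2 hτ)
      (summable_thetaC2 h) (summable_thetaC3 h)
      ((Equiv.addRight (1 : ℤ)).summable_iff.mpr (summable_thetaC3 h)) (summable_thetaC2 h) ?_ ?_ <;>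
    · intro s t
      simp only [← Complex.exp_add]
      push_cast
      ring_nf
  rw [sq, hsum]
  ring

lemma thetaC4_sq {τ : ℂ} (hτ : 0 < τ.im) :
    thetaC4 τ ^ 2 = thetaC3 (2 * τ) ^ 2 - thetaC2 (2 * τ) ^ 2 := by
  have h := im_two_mul_pos hτ
  have hsum : thetaC4 τ * thetaC4 τ =
      thetaC3 (2 * τ) * thetaC3 (2 * τ) + (∑' k : ℤ, -Complex.exp (((k : ℂ) + 1 / 2) ^ 2 *
        (Real.pi : ℂ) * I * (2 * τ))) * thetaC2 (2 * τ) := by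
    refine tsum_mul_tsum_eq_parity (summable_thetaC4 hτ) (summable_thetaC4 hτ)
      (summable_thetaC3 h) (summable_thetaC3 h) (summable_thetaC2 h).neg (summable_thetaC2 h) ?_ ?_
    · intro s t
      have hsign : (-1 : ℂ) ^ (s + t) * (-1 : ℂ) ^ (s - t) = 1 := by
        rw [← zpow_add₀ (by norm_num), show s + t + (s - t) = 2 * s by ring, zpow_mul]
        simp
      rw [mul_mul_mul_comm, hsign, one_mul]
      simp only [← Complex.exp_add]
      push_cast
      ring_nf
    · intro s t
      have hsign : (-1 : ℂ) ^ (s + t + 1) * (-1 : ℂ) ^ (s - t) = -1 := by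
        rw [← zpow_add₀ (by norm_num), show s + t + 1 + (s - t) = 2 * s + 1 by ring,
          zpow_add₀ (by norm_num), zpow_mul]
        simp
      rw [mul_mul_mul_comm, hsign, neg_one_mul, neg_mul]
      simp only [← Complex.exp_add]
      push_cast
      ring_nf
  rw [sq, hsum, tsum_neg]
  simp only [thetaC2]
  ring

/-- Jacobi's identity between the fourth powers of the theta-constants. -/
lemma thetaC3_pow_four {τ : ℂ} (hτ : 0 < τ.im) :
    thetaC3 τ ^ 4 = thetaC2 τ ^ 4 + thetaC4 τ ^ 4 := by
  linear_combination (thetaC3 τ ^ 2 + thetaC3 (2 * τ) ^ 2 + thetaC2 (2 * τ) ^ 2) * thetaC3_sq hτ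
    - (thetaC2 τ ^ 2 + 2 * thetaC2 (2 * τ) * thetaC3 (2 * τ)) * thetaC2_sq hτ
    - (thetaC4 τ ^ 2 + thetaC3 (2 * τ) ^ 2 - thetaC2 (2 * τ) ^ 2) * thetaC4_sq hτ

lemma thetaC4_two_mul_pow_four {τ : ℂ} (hτ : 0 < τ.im) :
    thetaC4 (2 * τ) ^ 4 = thetaC3 τ ^ 2 * thetaC4 τ ^ 2 := by
  rw [thetaC3_sq hτ, thetaC4_sq hτ]
  linear_combination -thetaC3_pow_four (im_two_mul_pos hτ)

/-- Behaviour at `i∞` of a series `∑ cₖ exp (πi eₖ τ)` with nonnegative integer exponents. -/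
lemma tendsto_tsum_exp_im_atTop (c : ℤ → ℂ) (e : ℤ → ℤ) (he : ∀ k, 0 ≤ e k)
    (hs : Summable fun k ↦ c k * Complex.exp ((e k : ℂ) * (Real.pi : ℂ) * I * I)) :
    Tendsto (fun τ : ℂ ↦ ∑' k, c k * Complex.exp ((e k : ℂ) * (Real.pi : ℂ) * I * τ))
      (comap im atTop) (𝓝 (∑' k, if e k = 0 then c k else 0)) := by
  have hnorm (k : ℤ) (τ : ℂ) : ‖c k * Complex.exp ((e k : ℂ) * (Real.pi : ℂ) * I * τ)‖ =
      ‖c k‖ * Real.exp (-((e k : ℝ) * Real.pi * τ.im)) := by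
    rw [norm_mul, Complex.norm_exp]
    congr 2
    rw [show (e k : ℂ) * (Real.pi : ℂ) * I * τ = ((e k * Real.pi : ℝ) : ℂ) * (I * τ) by
      push_cast; ring, re_ofReal_mul]
    simp
  refine tendsto_tsum_of_dominated_convergence hs.norm (fun k ↦ ?_) ?_
  · split_ifs with hk
    · simpa [hk] using tendsto_const_nhds
    · have hpos : (0 : ℝ) < e k * Real.pi :=
        mul_pos (by exact_mod_cast lt_of_le_of_ne (he k) (Ne.symm hk)) Real.pi_pos
      rw [tendsto_zero_iff_norm_tendsto_zero]
      simp_rw [hnorm]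
      have hlim : Tendsto (fun τ : ℂ ↦ (e k : ℝ) * Real.pi * τ.im) (comap im atTop) atTop :=
        tendsto_comap.const_mul_atTop hpos
      simpa using (Real.tendsto_exp_neg_atTop_nhds_zero.comp hlim).const_mul ‖c k‖
  · filter_upwards [tendsto_comap.eventually_ge_atTop (1 : ℝ)] with τ hτ k
    rw [hnorm, hnorm, I_im]
    have hk : (0 : ℝ) ≤ e k := by exact_mod_cast he k
    gcongr

lemma tendsto_thetaC3_im_atTop : Tendsto thetaC3 (comap im atTop) (𝓝 1) := by
  have h := tendsto_tsum_exp_im_atTop (fun _ ↦ 1) (fun k ↦ k ^ 2) (fun k ↦ sq_nonneg k)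
    (by simpa using summable_thetaC3 (τ := I) (by simp))
  simpa [funext thetaC3.eq_1, tsum_ite_eq] using h

lemma tendsto_thetaC4_im_atTop : Tendsto thetaC4 (comap im atTop) (𝓝 1) := by
  have h := tendsto_tsum_exp_im_atTop (fun k ↦ (-1) ^ k) (fun k ↦ k ^ 2) (fun k ↦ sq_nonneg k)
    (by simpa using summable_thetaC4 (τ := I) (by simp))
  have hval : (∑' k : ℤ, if k ^ 2 = 0 then (-1 : ℂ) ^ k else 0) = 1 := by
    rw [tsum_eq_single 0 (by intro k hk; simp [hk])]
    simp
  rw [hval] at h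
  simpa [funext thetaC4.eq_1] using h

lemma tendsto_thetaC2Reduced_im_atTop : Tendsto thetaC2Reduced (comap im atTop) (𝓝 2) := by
  have h := tendsto_tsum_exp_im_atTop (fun _ ↦ 1) (fun k ↦ k * (k + 1))
    (fun k ↦ by rcases lt_or_ge k 0 with hk | hk <;> nlinarith)
    (by simpa using summable_thetaC2Reduced (τ := I) (by simp))
  have hval : (∑' k : ℤ, if k * (k + 1) = 0 then (1 : ℂ) else 0) = 2 := by
    rw [tsum_eq_sum (s := {0, -1}) (by
      intro k hk
      simp only [Finset.mem_insert, Finset.mem_singleton, not_or] at hk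
      have : k + 1 ≠ 0 := fun h ↦ hk.2 (by lia)
      simp [hk.1, this])]
    rw [Finset.sum_pair (by simp)]
    norm_num
  rw [hval] at h
  simpa [funext thetaC2Reduced.eq_1] using h

/-- By Cauchy's estimate, the derivative of a holomorphic function with a limit at `i∞` tends
to zero. -/
lemma tendsto_deriv_im_atTop {f : ℂ → ℂ} {c : ℂ}
    (hf : ∀ τ : ℂ, 0 < τ.im → DifferentiableAt ℂ f τ)
    (hc : Tendsto f (comap im atTop) (𝓝 c)) :
    Tendsto (deriv f) (comap im atTop) (𝓝 0) := by
  rw [Metric.tendsto_nhds]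
  intro ε hε
  obtain ⟨M, hM⟩ := eventually_atTop.mp
    (eventually_comap.mp (Metric.tendsto_nhds.mp hc (ε / 2) (half_pos hε)))
  filter_upwards [tendsto_comap.eventually_ge_atTop (max M 0 + 2)] with τ hτ
  have him {z : ℂ} (hz : z ∈ Metric.closedBall τ 1) : max M 0 < z.im := by
    have h1 := (abs_im_le_norm (z - τ)).trans (mem_closedBall_iff_norm.mp hz)
    rw [sub_im] at h1
    linarith [(abs_le.mp h1).1]
  have hd : DifferentiableOn ℂ (fun z ↦ f z - c) (Metric.closedBall τ 1) := fun z hz ↦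
    ((hf z ((le_max_right _ _).trans_lt (him hz))).sub_const c).differentiableWithinAt
  have hbound := Complex.norm_deriv_le_of_forall_mem_sphere_norm_le one_pos
    (hd.diffContOnCl_ball le_rfl) (C := ε / 2) fun z hz ↦ by
      rw [← dist_eq_norm]
      exact (hM z.im ((le_max_left _ _).trans
        (him (Metric.sphere_subset_closedBall hz)).le) z rfl).le
  rw [deriv_sub_const] at hbound
  rw [dist_zero_right]
  linarith

lemma im_two_pow_mul_pos {τ : ℂ} (hτ : 0 < τ.im) (n : ℕ) : 0 < (2 ^ n * τ).im := by
  rw [show (2 : ℂ) ^ n = ((2 ^ n : ℝ) : ℂ) by push_cast; rfl, im_ofReal_mul]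
  positivity

lemma tendsto_two_pow_mul_comap_im_atTop {τ : ℂ} (hτ : 0 < τ.im) :
    Tendsto (fun n : ℕ ↦ (2 : ℂ) ^ n * τ) atTop (comap im atTop) := by
  rw [tendsto_comap_iff]
  have h : im ∘ (fun n : ℕ ↦ (2 : ℂ) ^ n * τ) = fun n ↦ (2 : ℝ) ^ n * τ.im := by
    ext n
    rw [Function.comp_apply, show (2 : ℂ) ^ n = ((2 ^ n : ℝ) : ℂ) by push_cast; rfl, im_ofReal_mul]
  rw [h]
  exact (tendsto_pow_atTop_atTop_of_one_lt one_lt_two).atTop_mul_const hτ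

/-- A property that descends from `2τ` to `τ` and holds near `i∞` holds on the upper half-plane. -/
lemma of_two_mul_of_eventually {p : ℂ → Prop} (hp : ∀ τ : ℂ, 0 < τ.im → p (2 * τ) → p τ)
    (hev : ∀ᶠ τ in comap im atTop, p τ) {τ : ℂ} (hτ : 0 < τ.im) : p τ := by
  obtain ⟨n, hn⟩ := ((tendsto_two_pow_mul_comap_im_atTop hτ).eventually hev).exists
  induction n with
  | zero => simpa using hn
  | succ n ih =>
    refine ih (hp _ (im_two_pow_mul_pos hτ n) ?_)
    rwa [← mul_assoc, ← pow_succ']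

lemma thetaC4_ne_zero {τ : ℂ} (hτ : 0 < τ.im) : thetaC4 τ ≠ 0 := by
  refine of_two_mul_of_eventually (p := fun τ ↦ thetaC4 τ ≠ 0) (fun τ hτ h h0 ↦ ?_)
    (tendsto_thetaC4_im_atTop.eventually_ne one_ne_zero) hτ
  have h4 := thetaC4_two_mul_pow_four hτ
  rw [h0] at h4
  exact h (by simpa using h4)

lemma thetaC3_ne_zero {τ : ℂ} (hτ : 0 < τ.im) : thetaC3 τ ≠ 0 := by
  intro h0
  have h4 := thetaC4_two_mul_pow_four hτ
  rw [h0] at h4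
  exact thetaC4_ne_zero (im_two_mul_pos hτ) (by simpa using h4)

lemma thetaC2_ne_zero {τ : ℂ} (hτ : 0 < τ.im) : thetaC2 τ ≠ 0 := by
  refine of_two_mul_of_eventually (p := fun τ ↦ thetaC2 τ ≠ 0) (fun τ hτ h h0 ↦ ?_) ?_ hτ
  · have h2 := thetaC2_sq hτ
    rw [h0] at h2
    have h3 := thetaC3_ne_zero (im_two_mul_pos hτ)
    simp [h, h3] at h2
  · filter_upwards [tendsto_thetaC2Reduced_im_atTop.eventually_ne two_ne_zero] with τ h
    rw [thetaC2_eq]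
    exact mul_ne_zero (Complex.exp_ne_zero _) h

lemma eventually_im_pos {τ : ℂ} (hτ : 0 < τ.im) : ∀ᶠ z in 𝓝 τ, 0 < z.im :=
  (isOpen_lt continuous_const continuous_im).mem_nhds hτ

lemma hasDerivAt_comp_two_mul {f : ℂ → ℂ} {τ : ℂ} (hf : DifferentiableAt ℂ f (2 * τ)) :
    HasDerivAt (fun z ↦ f (2 * z)) (2 * deriv f (2 * τ)) τ := by
  have h : HasDerivAt (fun z : ℂ ↦ 2 * z) 2 τ := by
    simpa using (hasDerivAt_id τ).const_mul (2 : ℂ)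
  exact (hf.hasDerivAt.comp τ h).congr_deriv (mul_comm _ _)

lemma thetaC3_mul_deriv {τ : ℂ} (hτ : 0 < τ.im) :
    thetaC3 τ * deriv thetaC3 τ = 2 * (thetaC3 (2 * τ) * deriv thetaC3 (2 * τ) +
      thetaC2 (2 * τ) * deriv thetaC2 (2 * τ)) := by
  have h := im_two_mul_pos hτ
  have hl := (differentiableAt_thetaC3 hτ).hasDerivAt.pow 2
  have hr := ((hasDerivAt_comp_two_mul (differentiableAt_thetaC3 h)).pow 2).add
    ((hasDerivAt_comp_two_mul (differentiableAt_thetaC2 h)).pow 2)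
  have heq := hl.unique (hr.congr_of_eventuallyEq
    ((eventually_im_pos hτ).mono fun z hz ↦ thetaC3_sq hz))
  norm_num at heq
  linear_combination heq / 2

lemma thetaC2_mul_deriv {τ : ℂ} (hτ : 0 < τ.im) :
    thetaC2 τ * deriv thetaC2 τ = 2 * (deriv thetaC2 (2 * τ) * thetaC3 (2 * τ) +
      thetaC2 (2 * τ) * deriv thetaC3 (2 * τ)) := by
  have h := im_two_mul_pos hτ
  have hl := (differentiableAt_thetaC2 hτ).hasDerivAt.pow 2
  have hr := ((hasDerivAt_comp_two_mul (differentiableAt_thetaC2 h)).const_mul 2).mul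
    (hasDerivAt_comp_two_mul (differentiableAt_thetaC3 h))
  have heq := hl.unique (hr.congr_of_eventuallyEq
    ((eventually_im_pos hτ).mono fun z hz ↦ thetaC2_sq hz))
  norm_num at heq
  linear_combination heq / 2

lemma deriv_thetaC3_pow_four {τ : ℂ} (hτ : 0 < τ.im) :
    thetaC3 τ ^ 3 * deriv thetaC3 τ =
      thetaC2 τ ^ 3 * deriv thetaC2 τ + thetaC4 τ ^ 3 * deriv thetaC4 τ := by
  have hl := (differentiableAt_thetaC3 hτ).hasDerivAt.pow 4
  have hr := ((differentiableAt_thetaC2 hτ).hasDerivAt.pow 4).add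
    ((differentiableAt_thetaC4 hτ).hasDerivAt.pow 4)
  have heq := hl.unique (hr.congr_of_eventuallyEq
    ((eventually_im_pos hτ).mono fun z hz ↦ thetaC3_pow_four hz))
  norm_num at heq
  linear_combination heq / 4

/-- The logarithmic derivative of `ϑ₂/ϑ₃` divided by `ϑ₄⁴`. -/
noncomputable def thetaLogDerivQuotient (τ : ℂ) : ℂ :=
  (deriv thetaC2 τ / thetaC2 τ - deriv thetaC3 τ / thetaC3 τ) / thetaC4 τ ^ 4

lemma thetaLogDerivQuotient_two_mul {τ : ℂ} (hτ : 0 < τ.im) :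
    thetaLogDerivQuotient (2 * τ) = thetaLogDerivQuotient τ := by
  have h := im_two_mul_pos hτ
  have h2 := thetaC2_ne_zero hτ
  have h3 := thetaC3_ne_zero hτ
  have h4 := thetaC4_ne_zero hτ
  have k2 := thetaC2_ne_zero h
  have k3 := thetaC3_ne_zero h
  have l2 : deriv thetaC2 τ / thetaC2 τ = deriv thetaC2 (2 * τ) / thetaC2 (2 * τ) +
      deriv thetaC3 (2 * τ) / thetaC3 (2 * τ) := by
    rw [← mul_div_mul_left _ _ h2, ← sq, thetaC2_mul_deriv hτ, thetaC2_sq hτ]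
    field_simp
  have l3 : deriv thetaC3 τ / thetaC3 τ = 2 * (thetaC3 (2 * τ) * deriv thetaC3 (2 * τ) +
      thetaC2 (2 * τ) * deriv thetaC2 (2 * τ)) / thetaC3 τ ^ 2 := by
    rw [← mul_div_mul_left _ _ h3, ← sq, thetaC3_mul_deriv hτ]
  have s3 := thetaC3_sq hτ
  have s4 := thetaC4_sq hτ
  rw [thetaLogDerivQuotient, thetaLogDerivQuotient, l2, l3, thetaC4_two_mul_pow_four hτ,
    show thetaC4 τ ^ 4 = thetaC4 τ ^ 2 * thetaC4 τ ^ 2 by ring]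
  have n3 := pow_ne_zero 2 h3
  have n4 := pow_ne_zero 2 h4
  rw [s3] at n3 ⊢
  rw [s4] at n4 ⊢
  field_simp
  ring

lemma tendsto_thetaLogDerivQuotient_im_atTop :
    Tendsto thetaLogDerivQuotient (comap im atTop) (𝓝 (I * (Real.pi : ℂ) / 4)) := by
  have hg := (tendsto_deriv_im_atTop (fun _ ↦ differentiableAt_thetaC2Reduced)
    tendsto_thetaC2Reduced_im_atTop).div tendsto_thetaC2Reduced_im_atTop two_ne_zero
  have h3 := (tendsto_deriv_im_atTop (fun _ ↦ differentiableAt_thetaC3)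
    tendsto_thetaC3_im_atTop).div tendsto_thetaC3_im_atTop one_ne_zero
  have hlim := ((hg.const_add (Real.pi * I / 4 : ℂ)).sub h3).div
    (tendsto_thetaC4_im_atTop.pow 4) (by norm_num)
  have hval : ((Real.pi : ℂ) * I / 4 + 0 / 2 - 0 / 1) / 1 ^ 4 = I * (Real.pi : ℂ) / 4 := by ring
  rw [hval] at hlim
  refine hlim.congr' ?_
  filter_upwards [tendsto_comap.eventually_gt_atTop (0 : ℝ),
    tendsto_thetaC2Reduced_im_atTop.eventually_ne two_ne_zero] with τ hτ hne
  have hexp := Complex.exp_ne_zero (Real.pi * I / 4 * τ)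
  simp only [Pi.div_apply, thetaLogDerivQuotient, (hasDerivAt_thetaC2 hτ).deriv, thetaC2_eq,
    mul_div_mul_left _ _ hexp, add_div, mul_div_cancel_right₀ _ hne]

lemma thetaLogDerivQuotient_eq {τ : ℂ} (hτ : 0 < τ.im) :
    thetaLogDerivQuotient τ = I * (Real.pi : ℂ) / 4 := by
  have hconst (n : ℕ) : thetaLogDerivQuotient (2 ^ n * τ) = thetaLogDerivQuotient τ := by
    induction n with
    | zero => simp
    | succ n ih =>
      rw [pow_succ', mul_assoc, thetaLogDerivQuotient_two_mul (im_two_pow_mul_pos hτ n), ih]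
  refine tendsto_nhds_unique ?_
    (tendsto_thetaLogDerivQuotient_im_atTop.comp (tendsto_two_pow_mul_comap_im_atTop hτ))
  simp only [Function.comp_def, hconst, tendsto_const_nhds]

/-- Logarithmic τ-derivatives of ratios of theta-constants, where
    d/dτ log (f/g) is understood as f'/f − g'/g. -/
theorem thetaConstant_log_derivatives (τ : ℂ) (hτ : 0 < τ.im) :
    deriv thetaC2 τ / thetaC2 τ - deriv thetaC3 τ / thetaC3 τ
        = I * (Real.pi : ℂ) / 4 * thetaC4 τ ^ 4
    ∧ deriv thetaC3 τ / thetaC3 τ - deriv thetaC4 τ / thetaC4 τ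
        = I * (Real.pi : ℂ) / 4 * thetaC2 τ ^ 4
    ∧ deriv thetaC2 τ / thetaC2 τ - deriv thetaC4 τ / thetaC4 τ
        = I * (Real.pi : ℂ) / 4 * thetaC3 τ ^ 4 := by
  have h2 := thetaC2_ne_zero hτ
  have h3 := thetaC3_ne_zero hτ
  have h4 := thetaC4_ne_zero hτ
  have h23 : deriv thetaC2 τ / thetaC2 τ - deriv thetaC3 τ / thetaC3 τ
      = I * (Real.pi : ℂ) / 4 * thetaC4 τ ^ 4 := by
    rw [← thetaLogDerivQuotient_eq hτ, thetaLogDerivQuotient,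
      div_mul_cancel₀ _ (pow_ne_zero 4 h4)]
  have h34 : deriv thetaC3 τ / thetaC3 τ - deriv thetaC4 τ / thetaC4 τ
      = I * (Real.pi : ℂ) / 4 * thetaC2 τ ^ 4 := by
    refine mul_left_cancel₀ (pow_ne_zero 4 h4) ?_
    have hd := deriv_thetaC3_pow_four hτ
    have e2 : thetaC2 τ ^ 3 * deriv thetaC2 τ =
        thetaC2 τ ^ 4 * (deriv thetaC2 τ / thetaC2 τ) := by field_simp
    have e3 : thetaC3 τ ^ 3 * deriv thetaC3 τ =
        thetaC3 τ ^ 4 * (deriv thetaC3 τ / thetaC3 τ) := by field_simp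
    have e4 : thetaC4 τ ^ 3 * deriv thetaC4 τ =
        thetaC4 τ ^ 4 * (deriv thetaC4 τ / thetaC4 τ) := by field_simp
    rw [e2, e3, e4] at hd
    linear_combination hd + thetaC2 τ ^ 4 * h23
      - deriv thetaC3 τ / thetaC3 τ * thetaC3_pow_four hτ
  exact ⟨h23, h34, by
    linear_combination h23 + h34 - I * (Real.pi : ℂ) / 4 * thetaC3_pow_four hτ⟩
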